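/- For any countable set C of worst-case value-stable environments there exists a policy p which is worst-case self-optimizing for C, i.e., liminf_m (1/m) r_{1..m}^{pν} ≥ W*_ν with probability 1 for every ν ∈ C. -/

import Mathlib

open MeasureTheory Filter Finset Asymptotics
open scoped ENNReal Classical

noncomputable section

namespace RL

/-- A perception `x = (r, o)`: a reward `r ∈ R = {0, …, r_max}` together with an
observation `o ∈ O`. -/
abbrev Percept (O : Type) (rmax : ℕ) := Fin (rmax + 1) × O

/-- A cycle `z = (y, r, o)`: an action together with the resulting perception. -/
abbrev Cycle (Y O : Type) (rmax : ℕ) := Y × Percept O rmax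

/-- A deterministic policy maps a history `z_{<k}` to the next action `y_k`. -/
abbrev Policy (Y O : Type) (rmax : ℕ) := List (Cycle Y O rmax) → Y

/-- An infinite interaction sequence. -/
abbrev Traj (Y O : Type) (rmax : ℕ) := ℕ → Cycle Y O rmax

instance (Y O : Type) (rmax : ℕ) : MeasurableSpace (Cycle Y O rmax) := ⊤

/-- The reward of a cycle `z = (y, (r, o))`, as a real number. -/
def rew {Y O : Type} {rmax : ℕ} (z : Cycle Y O rmax) : ℝ := ((z.2.1 : ℕ) : ℝ)

/-- The cylinder set of all infinite sequences extending the finite sequence `l`. -/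
def cylSet {A : Type} (l : List A) : Set (ℕ → A) := {ω | ∀ i : Fin l.length, ω i.1 = l.get i}

/-- An environment: conditional probabilities `ν(x_k | z_{<k} y_k)` of the next perception
given the history, together with, for each (deterministic) policy `p`, the induced
probability measure on interaction sequences, which on cylinder sets is given by the
product of the conditional probabilities (actions being forced by the policy). -/
structure Environment (Y O : Type) [Fintype Y] [Fintype O] (rmax : ℕ) where
  cond : List (Cycle Y O rmax) → Y → Percept O rmax → ℝ
  cond_nonneg : ∀ h y x, 0 ≤ cond h y x
  cond_sum_one : ∀ h y, ∑ x : Percept O rmax, cond h y x = 1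
  P : Policy Y O rmax → Measure (Traj Y O rmax)
  P_prob : ∀ p, IsProbabilityMeasure (P p)
  P_cyl : ∀ (p : Policy Y O rmax) (h : List (Cycle Y O rmax)) (z : Cycle Y O rmax),
    P p (cylSet (h ++ [z]))
      = P p (cylSet h) * ENNReal.ofReal (if z.1 = p h then cond h z.1 z.2 else 0)

variable {Y O : Type} [Fintype Y] [Fintype O] {rmax : ℕ}

/-- The average reward `(1/m) r_{1..m}` of the first `m` steps of a trajectory. -/
def avg {Y O : Type} {rmax : ℕ} (ω : Traj Y O rmax) (m : ℕ) : ℝ :=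
  (∑ i ∈ Finset.range m, rew (ω i)) / m

/-- `V(ν,p) = V` : the average limiting value exists a.s. and equals the constant `V`. -/
def ValueIs (ν : Environment Y O rmax) (p : Policy Y O rmax) (V : ℝ) : Prop :=
  ν.P p {ω | Tendsto (avg ω) atTop (nhds V)} = 1

/-- `V̄(ν,p) = V` : the upper limiting average value is a.s. the constant `V`. -/
def UpperValueIs (ν : Environment Y O rmax) (p : Policy Y O rmax) (V : ℝ) : Prop :=
  ν.P p {ω | limsup (avg ω) atTop = V} = 1

/-- `V` is the optimal value `V*_ν` of `ν`: some policy `p_ν` achieves average value `V`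
a.s., and every policy has upper average value `≤ V` a.s. -/
def IsOptimalValue (ν : Environment Y O rmax) (V : ℝ) : Prop :=
  ∃ p, ValueIs ν p V ∧ ∀ q : Policy Y O rmax, ν.P q {ω | limsup (avg ω) atTop ≤ V} = 1

/-- An environment is explorable if it has an optimal value `V*_ν`. -/
def Explorable (ν : Environment Y O rmax) : Prop := ∃ V, IsOptimalValue ν V

/-- `V` is the upper optimal value `V̄*_ν` of `ν`. -/
def IsUpperOptimalValue (ν : Environment Y O rmax) (V : ℝ) : Prop :=
  ∃ p, UpperValueIs ν p V ∧ ∀ q : Policy Y O rmax, ν.P q {ω | limsup (avg ω) atTop ≤ V} = 1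

/-- An environment is upper explorable if it has an upper optimal value `V̄*_ν`. -/
def UpperExplorable (ν : Environment Y O rmax) : Prop := ∃ V, IsUpperOptimalValue ν V

/-- `ν(x_{<k} | y_{<k})` : the probability of the perceptions of the history `h`,
given its actions. -/
def histProbX (ν : Environment Y O rmax) (h : List (Cycle Y O rmax)) : ℝ :=
  ∏ i : Fin h.length, ν.cond (h.take i.1) (h.get i).1 (h.get i).2

/-- Replace the first `k-1` actions of the policy `p` by the actions `y_{<k}` of the
history `h`. -/
def replacePolicy (h : List (Cycle Y O rmax)) (p : Policy Y O rmax) : Policy Y O rmax :=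
  fun l => if hl : l.length < h.length then (h.get ⟨l.length, hl⟩).1 else p l

/-- The measure induced by `(p, ν)` conditional on the history `h = z_{<k}`:
`ν`-probabilities conditional on `x_{<k}`, with the first `k-1` actions of `p`
replaced by `y_{<k}`. -/
def condMeasure (ν : Environment Y O rmax) (p : Policy Y O rmax)
    (h : List (Cycle Y O rmax)) : Measure (Traj Y O rmax) :=
  ProbabilityTheory.cond (ν.P (replacePolicy h p)) (cylSet h)

/-- `P( · | z_{<k})` under policy `p` in environment `ν`. -/
def condProb (ν : Environment Y O rmax) (p : Policy Y O rmax)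
    (h : List (Cycle Y O rmax)) (A : Set (Traj Y O rmax)) : ℝ≥0∞ :=
  condMeasure ν p h A

/-- `V(ν,p,z_{<k}) = V` : conditional on `z_{<k}`, the average limiting value is a.s. `V`. -/
def CondValueIs (ν : Environment Y O rmax) (p : Policy Y O rmax)
    (h : List (Cycle Y O rmax)) (V : ℝ) : Prop :=
  condProb ν p h {ω | Tendsto (avg ω) atTop (nhds V)} = 1

/-- `V̄(ν,p,z_{<k}) = V` : conditional on `z_{<k}`, the upper limiting average value
is a.s. `V`. -/
def CondUpperValueIs (ν : Environment Y O rmax) (p : Policy Y O rmax)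
    (h : List (Cycle Y O rmax)) (V : ℝ) : Prop :=
  condProb ν p h {ω | limsup (avg ω) atTop = V} = 1

/-- `V` is the conditional optimal value `V*_ν(z_{<k})`. -/
def IsCondOptimalValue (ν : Environment Y O rmax) (h : List (Cycle Y O rmax)) (V : ℝ) : Prop :=
  ∃ p, CondValueIs ν p h V ∧
    ∀ q : Policy Y O rmax, condProb ν q h {ω | limsup (avg ω) atTop ≤ V} = 1

/-- `V` is the conditional upper optimal value `V̄*_ν(z_{<k})`. -/
def IsCondUpperOptimalValue (ν : Environment Y O rmax) (h : List (Cycle Y O rmax)) (V : ℝ) :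
    Prop :=
  ∃ p, CondUpperValueIs ν p h V ∧
    ∀ q : Policy Y O rmax, condProb ν q h {ω | limsup (avg ω) atTop ≤ V} = 1

/-- Strongly explorable: after any history of positive probability there is a conditionally
optimal value. -/
def StronglyExplorable (ν : Environment Y O rmax) : Prop :=
  ∀ h, 0 < histProbX ν h → ∃ V, IsCondOptimalValue ν h V

/-- Strongly upper explorable. -/
def StronglyUpperExplorable (ν : Environment Y O rmax) : Prop :=
  ∀ h, 0 < histProbX ν h → ∃ V, IsCondUpperOptimalValue ν h V

/-- The worst-case optimal value `W*_ν = inf_{z_{<k}} V*_ν(z_{<k})`. -/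
def Wstar (ν : Environment Y O rmax) : ℝ :=
  sInf {V | ∃ h, 0 < histProbX ν h ∧ IsCondOptimalValue ν h V}

/-- The worst-case upper optimal value `W̄*_ν = inf_{z_{<k}} V̄*_ν(z_{<k})`. -/
def WstarUpper (ν : Environment Y O rmax) : ℝ :=
  sInf {V | ∃ h, 0 < histProbX ν h ∧ IsCondUpperOptimalValue ν h V}

/-- Recoverable: after any history of positive probability, some policy attains the
upper optimal value `V̄*_ν` with conditional probability 1. -/
def Recoverable (ν : Environment Y O rmax) : Prop :=
  ∃ V, IsUpperOptimalValue ν V ∧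
    ∀ h, 0 < histProbX ν h →
      ∃ p, condProb ν p h {ω | limsup (avg ω) atTop = V} = 1

/-- The quantitative part of value-stability, with target value `W`:
rewards `r_i ∈ [0, r_max]` with `(1/n) r_{1..n} → W`, `d(k,ε) = o(k)`,
`Σ_n φ(n,ε) < ∞`, and from any history `z_{<k}` some policy `p` recovers:
`P( r_{k..k+n} − r^{pν}_{k..k+n} > d(k,ε) + nε | z_{<k} ) ≤ φ(n,ε)`. -/
def ValueStableCore (ν : Environment Y O rmax) (W : ℝ) (r : ℕ → ℝ)
    (d : ℕ → ℝ → ℝ) (φ : ℕ → ℝ → ℝ) : Prop :=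
  (∀ i, r i ∈ Set.Icc (0 : ℝ) (rmax : ℝ)) ∧
  Tendsto (fun n => (∑ i ∈ Finset.range n, r i) / n) atTop (nhds W) ∧
  (∀ ε : ℝ, 0 < ε → (fun k : ℕ => d k ε) =o[atTop] fun k : ℕ => (k : ℝ)) ∧
  (∀ ε : ℝ, 0 < ε → Summable fun n => φ n ε) ∧
  ∀ h : List (Cycle Y O rmax), ∃ p : Policy Y O rmax, ∀ ε : ℝ, 0 < ε → ∀ n : ℕ,
    condProb ν p h
      {ω | d h.length ε + n * ε <
        (∑ i ∈ Finset.Icc h.length (h.length + n), r i)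
          - ∑ i ∈ Finset.Icc h.length (h.length + n), rew (ω i)}
      ≤ ENNReal.ofReal (φ n ε)

/-- Value-stability with explicit witnesses `V = V*_ν`, `r`, `d`, `φ`. -/
def ValueStableWith (ν : Environment Y O rmax) (V : ℝ) (r : ℕ → ℝ)
    (d : ℕ → ℝ → ℝ) (φ : ℕ → ℝ → ℝ) : Prop :=
  IsOptimalValue ν V ∧ ValueStableCore ν V r d φ

/-- A value-stable environment. -/
def ValueStable (ν : Environment Y O rmax) : Prop :=
  ∃ V r d φ, ValueStableWith ν V r d φ

/-- A worst-case value-stable environment: strongly explorable, and the value-stability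
condition holds with target `W*_ν`. -/
def WorstCaseValueStable (ν : Environment Y O rmax) : Prop :=
  StronglyExplorable ν ∧ ∃ r d φ, ValueStableCore ν (Wstar ν) r d φ

/-- A policy is self-optimizing for a class `C` if it attains the optimal value `V*_ν`
in every `ν ∈ C`. -/
def SelfOptimizing (p : Policy Y O rmax) (C : Set (Environment Y O rmax)) : Prop :=
  ∀ ν ∈ C, ∀ V, IsOptimalValue ν V → ValueIs ν p V

/-- A policy is upper self-optimizing for a class `C` if it attains the upper optimal
value `V̄*_ν` in every `ν ∈ C`. -/
def UpperSelfOptimizing (p : Policy Y O rmax) (C : Set (Environment Y O rmax)) : Prop :=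
  ∀ ν ∈ C, ∀ V, IsUpperOptimalValue ν V → UpperValueIs ν p V

/-- A deterministic environment: all conditional probabilities are `0` or `1`. -/
def Deterministic (ν : Environment Y O rmax) : Prop :=
  ∀ h y x, ν.cond h y x = 0 ∨ ν.cond h y x = 1

/-- In a deterministic environment, the perception following history `h` and action `y`. -/
def pick [Nonempty O] (ν : Environment Y O rmax) (h : List (Cycle Y O rmax)) (y : Y) :
    Percept O rmax :=
  if hx : ∃ x, ν.cond h y x = 1 then hx.choose else Classical.arbitrary _

/-- The (deterministic) history generated by policy `p` in a deterministic environment. -/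
def detHist [Nonempty O] (ν : Environment Y O rmax) (p : Policy Y O rmax) :
    ℕ → List (Cycle Y O rmax)
  | 0 => []
  | n + 1 =>
      detHist ν p n ++ [(p (detHist ν p n), pick ν (detHist ν p n) (p (detHist ν p n)))]

/-- The cycle `z_n` generated by policy `p` in a deterministic environment. -/
def detZ [Nonempty O] (ν : Environment Y O rmax) (p : Policy Y O rmax) (n : ℕ) :
    Cycle Y O rmax :=
  (p (detHist ν p n), pick ν (detHist ν p n) (p (detHist ν p n)))

end RL

namespace RL

section Prefixes

variable {Y O : Type} {rmax : ℕ}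

/-- The first `n` cycles of a trajectory, as a history. -/
def initSeg (ω : Traj Y O rmax) (n : ℕ) : List (Cycle Y O rmax) := (List.range n).map ω

@[simp] lemma length_initSeg (ω : Traj Y O rmax) (n : ℕ) : (initSeg ω n).length = n := by
  simp [initSeg]

lemma initSeg_succ (ω : Traj Y O rmax) (n : ℕ) :
    initSeg ω (n + 1) = initSeg ω n ++ [ω n] := by
  simp [initSeg, List.range_succ]

lemma take_initSeg (ω : Traj Y O rmax) {k n : ℕ} (h : k ≤ n) :
    (initSeg ω n).take k = initSeg ω k := by
  simp [initSeg, ← List.map_take, List.take_range, h]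

lemma initSeg_congr {ω ω' : Traj Y O rmax} {n : ℕ} (h : ∀ i < n, ω i = ω' i) :
    initSeg ω n = initSeg ω' n := by
  simpa [initSeg] using h

lemma mem_cylSet_initSeg {ω v : Traj Y O rmax} {n : ℕ} :
    ω ∈ cylSet (initSeg v n) ↔ ∀ i < n, ω i = v i := by
  constructor
  · intro h i hi
    have := h ⟨i, by simpa using hi⟩
    simpa [initSeg] using this
  · intro h i
    have hv : (initSeg v n).get i = v i.1 := by
      rw [List.get_eq_getElem]
      simp [initSeg]
    rw [hv]
    exact h i.1 (by simpa using i.2)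

lemma self_mem_cylSet (ω : Traj Y O rmax) (n : ℕ) : ω ∈ cylSet (initSeg ω n) :=
  mem_cylSet_initSeg.2 fun _ _ => rfl

lemma initSeg_eq_of_mem {ω : Traj Y O rmax} {h : List (Cycle Y O rmax)} (hω : ω ∈ cylSet h) :
    initSeg ω h.length = h := by
  apply List.ext_get (by simp)
  intro n h1 h2
  simpa [initSeg] using hω ⟨n, h2⟩

lemma cylSet_anti (ω : Traj Y O rmax) {k n : ℕ} (h : k ≤ n) :
    cylSet (initSeg ω n) ⊆ cylSet (initSeg ω k) := by
  intro v hv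
  rw [mem_cylSet_initSeg] at hv ⊢
  exact fun i hi => hv i (hi.trans_le h)

lemma measurableSet_cylSet (h : List (Cycle Y O rmax)) : MeasurableSet (cylSet h) := by
  have : cylSet h = ⋂ i : Fin h.length, (fun ω : Traj Y O rmax => ω i.1) ⁻¹' {h.get i} := by
    ext ω; simp [cylSet]
  rw [this]
  exact MeasurableSet.iInter fun i => measurable_pi_apply i.1 trivial

/-- Extend a history to a trajectory by an arbitrary constant. -/
def extend [Nonempty (Cycle Y O rmax)] (h : List (Cycle Y O rmax)) : Traj Y O rmax :=
  fun i => h.getD i (Classical.arbitrary _)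

lemma extend_initSeg [Nonempty (Cycle Y O rmax)] (ω : Traj Y O rmax) {n i : ℕ} (h : i < n) :
    extend (initSeg ω n) i = ω i := by
  simp [extend, initSeg, h]

lemma extend_of_mem [Nonempty (Cycle Y O rmax)] {h : List (Cycle Y O rmax)} {ω : Traj Y O rmax}
    (hω : ω ∈ cylSet h) {i : ℕ} (hi : i < h.length) : extend h i = ω i := by
  conv_lhs => rw [← initSeg_eq_of_mem hω]
  exact extend_initSeg ω hi

/-- A set determined by the first `n` cycles is a union of cylinders. -/
lemma eq_iUnion_cylSet {E : Set (Traj Y O rmax)} (n : ℕ)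
    (hE : ∀ ω ω' : Traj Y O rmax, (∀ i < n, ω i = ω' i) → ω ∈ E → ω' ∈ E) :
    E = ⋃ h : {h : List (Cycle Y O rmax) // ∃ ω ∈ E, h = initSeg ω n}, cylSet h.1 := by
  ext ω
  simp only [Set.mem_iUnion, Subtype.exists, exists_prop]
  constructor
  · exact fun h => ⟨_, ⟨ω, h, rfl⟩, self_mem_cylSet ω n⟩
  · rintro ⟨_, ⟨v, hv, rfl⟩, h⟩
    exact hE v ω (fun i hi => (mem_cylSet_initSeg.1 h i hi).symm) hv

lemma rew_nonneg (z : Cycle Y O rmax) : 0 ≤ rew z := by simp [rew]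

lemma rew_le (z : Cycle Y O rmax) : rew z ≤ rmax := by
  have := z.2.1.2
  simp only [rew]
  exact_mod_cast Nat.lt_succ_iff.1 this

end Prefixes

section Measures

variable {Y O : Type} [Fintype Y] [Fintype O] {rmax : ℕ} (ν : Environment Y O rmax)

instance (p : Policy Y O rmax) : IsProbabilityMeasure (ν.P p) := ν.P_prob p

lemma measurableSet_of_determined {E : Set (Traj Y O rmax)} (n : ℕ)
    (hE : ∀ ω ω' : Traj Y O rmax, (∀ i < n, ω i = ω' i) → ω ∈ E → ω' ∈ E) :
    MeasurableSet E := by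
  rw [eq_iUnion_cylSet n hE]
  exact MeasurableSet.iUnion fun h => measurableSet_cylSet _

lemma measure_cylSet_succ (p : Policy Y O rmax) (ω : Traj Y O rmax) (n : ℕ) :
    ν.P p (cylSet (initSeg ω (n + 1))) = ν.P p (cylSet (initSeg ω n)) * ENNReal.ofReal
      (if (ω n).1 = p (initSeg ω n) then ν.cond (initSeg ω n) (ω n).1 (ω n).2 else 0) := by
  rw [initSeg_succ, ν.P_cyl]

/-- Policies making the same choices along a history give its cylinder the same probability. -/
lemma measure_cylSet_congr {p q : Policy Y O rmax} (ω : Traj Y O rmax) (n : ℕ)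
    (h : ∀ i < n, p (initSeg ω i) = q (initSeg ω i)) :
    ν.P p (cylSet (initSeg ω n)) = ν.P q (cylSet (initSeg ω n)) := by
  induction n with
  | zero =>
    have : cylSet (initSeg ω 0) = Set.univ := by
      ext v; simp [mem_cylSet_initSeg]
    simp [this]
  | succ n ih =>
    rw [measure_cylSet_succ, measure_cylSet_succ, ih fun i hi => h i (by omega),
      h n (by omega)]

lemma action_eq_of_measure_ne_zero {p : Policy Y O rmax} {ω : Traj Y O rmax} {n : ℕ}
    (h : ν.P p (cylSet (initSeg ω n)) ≠ 0) {i : ℕ} (hi : i < n) :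
    (ω i).1 = p (initSeg ω i) := by
  by_contra hne
  apply h
  refine measure_mono_null (cylSet_anti ω (Nat.succ_le_of_lt hi)) ?_
  rw [measure_cylSet_succ, if_neg hne]
  simp

/-- Two policies which make the same choices along every member of a set determined by the first
`n` cycles give it the same probability. -/
lemma measure_congr_of_determined {p q : Policy Y O rmax} {E : Set (Traj Y O rmax)} (n : ℕ)
    (hE : ∀ ω ω' : Traj Y O rmax, (∀ i < n, ω i = ω' i) → ω ∈ E → ω' ∈ E)
    (hpq : ∀ ω ∈ E, ∀ i < n, p (initSeg ω i) = q (initSeg ω i)) :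
    ν.P p E = ν.P q E := by
  have hdisj : Pairwise (Function.onFun Disjoint
      fun h : {h : List (Cycle Y O rmax) // ∃ ω ∈ E, h = initSeg ω n} => cylSet h.1) := by
    rintro ⟨_, v, hv, rfl⟩ ⟨_, w, hw, rfl⟩ hne
    refine Set.disjoint_left.2 fun ω h1 h2 => hne (Subtype.ext ?_)
    have e1 := initSeg_eq_of_mem h1
    have e2 := initSeg_eq_of_mem h2
    simp only [length_initSeg] at e1 e2
    exact e1.symm.trans e2
  rw [eq_iUnion_cylSet n hE, measure_iUnion hdisj fun h => measurableSet_cylSet _,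
    measure_iUnion hdisj fun h => measurableSet_cylSet _]
  congr 1
  ext ⟨_, v, hv, rfl⟩
  exact measure_cylSet_congr ν v n (hpq v hv)

lemma ValueStableCore.target_le {ν : Environment Y O rmax} {W : ℝ} {r : ℕ → ℝ}
    {d φ : ℕ → ℝ → ℝ} (hν : ValueStableCore ν W r d φ) : W ≤ rmax := by
  obtain ⟨hr, hlim, -⟩ := hν
  refine le_of_tendsto' hlim fun n => ?_
  refine div_le_of_le_mul₀ (by positivity) (by positivity) ?_
  calc ∑ i ∈ Finset.range n, r i ≤ ∑ i ∈ Finset.range n, (rmax : ℝ) :=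
        Finset.sum_le_sum fun i _ => (hr i).2
    _ = rmax * n := by simp [mul_comm]

/-- Value-stability, restated: from every late enough history `h` the policy `pol h` collects,
with high probability and uniformly in time, an average reward not much below `W`. -/
lemma ValueStableCore.exists_policy {ν : Environment Y O rmax} {W : ℝ} {r : ℕ → ℝ}
    {d φ : ℕ → ℝ → ℝ} (hν : ValueStableCore ν W r d φ) :
    ∃ pol : List (Cycle Y O rmax) → Policy Y O rmax, ∀ η : ℝ, 0 < η → ∀ δ : ℝ≥0∞, 0 < δ →
      ∃ M : ℕ, ∀ h : List (Cycle Y O rmax), M ≤ h.length →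
        condProb ν (pol h) h
          {ω | ∃ n : ℕ, ∑ i ∈ Finset.Ico h.length (h.length + n + 1), rew (ω i)
            < W * (n + 1) - η * (h.length + n + 1)} ≤ δ := by
  obtain ⟨-, hlim, hd, hφ, hpol⟩ := id hν
  choose pol hpol using hpol
  refine ⟨pol, fun η hη δ hδ => ?_⟩
  have hε : 0 < η / 4 := by positivity
  have hWr := hν.target_le
  have hsum : ∑' n, ENNReal.ofReal (φ n (η / 4)) ≠ ⊤ := by
    refine ne_top_of_le_ne_top (hφ _ hε).abs.tsum_ofReal_ne_top ?_
    exact ENNReal.tsum_le_tsum fun n => ENNReal.ofReal_le_ofReal (le_abs_self _)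
  obtain ⟨N, hN⟩ := ((ENNReal.tendsto_sum_nat_add _ hsum).eventually_lt_const hδ).exists
  have h1 : ∀ᶠ k : ℕ in atTop, d k (η / 4) ≤ η / 4 * k := by
    filter_upwards [(hd _ hε).bound hε] with k hk
    refine (le_abs_self _).trans ?_
    simpa using hk
  have h2 : ∀ᶠ k : ℕ in atTop, |∑ i ∈ Finset.range k, r i - W * k| ≤ η / 4 * k := by
    filter_upwards [Metric.tendsto_atTop'.1 hlim (η / 4) hε |>.elim
      (fun N h => eventually_atTop.2 ⟨N + 1, fun n hn => h n (by omega)⟩), eventually_gt_atTop 0]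
      with k hk hk0
    have hk0' : (0 : ℝ) < k := by exact_mod_cast hk0
    rw [Real.dist_eq, ← mul_lt_mul_iff_left₀ hk0', ← abs_of_pos hk0', ← abs_mul,
      abs_of_pos hk0', sub_mul, div_mul_cancel₀ _ hk0'.ne'] at hk
    exact hk.le
  have h3 : ∀ᶠ k : ℕ in atTop, (rmax : ℝ) * N ≤ η * k :=
    (tendsto_natCast_atTop_atTop.const_mul_atTop hη).eventually_ge_atTop _
  obtain ⟨M, hM⟩ := eventually_atTop.1 ((h1.and h2).and h3)
  refine ⟨M, fun h hh => ?_⟩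
  set k := h.length with hk
  refine le_trans ?_ hN.le
  refine le_trans (measure_mono (t := ⋃ n, {ω : Traj Y O rmax |
    d k (η / 4) + (n + N : ℕ) * (η / 4) < (∑ i ∈ Finset.Icc k (k + (n + N)), r i)
          - ∑ i ∈ Finset.Icc k (k + (n + N)), rew (ω i)}) ?_)
    ((measure_iUnion_le _).trans (ENNReal.tsum_le_tsum fun n => hpol h _ hε (n + N)))
  rintro ω ⟨n, hn⟩
  obtain ⟨⟨a1, a2⟩, a3⟩ := hM k hh
  have b2 := (hM (k + n + 1) (by omega)).1.2
  have hnonneg : 0 ≤ ∑ i ∈ Finset.Ico k (k + n + 1), rew (ω i) :=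
    Finset.sum_nonneg fun i _ => rew_nonneg _
  have hNn : N ≤ n := by
    by_contra hlt
    have hle : (n : ℝ) + 1 ≤ N := by exact_mod_cast (by omega : n + 1 ≤ N)
    have c1 : W * (n + 1) ≤ rmax * N :=
      mul_le_mul hWr hle (by positivity) (by positivity)
    nlinarith [mul_nonneg hη.le (by positivity : (0 : ℝ) ≤ n + 1)]
  obtain ⟨n, rfl⟩ : ∃ m, n = m + N := ⟨n - N, by omega⟩
  refine Set.mem_iUnion.2 ⟨n, ?_⟩
  have hIcc : Finset.Icc k (k + (n + N)) = Finset.Ico k (k + (n + N) + 1) := by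
    ext; simp
  simp only [Set.mem_ofPred_eq, hIcc]
  have e := Finset.sum_range_add_sum_Ico r (show k ≤ k + (n + N) + 1 by omega)
  rw [abs_le] at a2 b2
  push_cast at hn b2 e ⊢
  nlinarith [a2.2, b2.1, mul_nonneg hη.le (by positivity : (0 : ℝ) ≤ n + N)]

end Measures

section Strategy

/-- Tolerance of the reward test during phase `s`. -/
def slack (s : ℕ) : ℝ := 1 / ((s : ℝ) + 1) ^ 2

lemma slack_pos (s : ℕ) : 0 < slack s := by unfold slack; positivity

/-- An element of `A` of largest weight. -/
def argMax (W : ℕ → ℝ) (A : Finset ℕ) : ℕ :=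
  if h : A.Nonempty then (A.exists_max_image W h).choose else 0

lemma le_argMax (W : ℕ → ℝ) {A : Finset ℕ} {T : ℕ} (hT : T ∈ A) : W T ≤ W (argMax W A) := by
  have h : A.Nonempty := ⟨T, hT⟩
  rw [argMax, dif_pos h]
  exact (A.exists_max_image W h).choose_spec.2 T hT

lemma argMax_mem (W : ℕ → ℝ) {A : Finset ℕ} (h : A.Nonempty) : argMax W A ∈ A := by
  rw [argMax, dif_pos h]
  exact (A.exists_max_image W h).choose_spec.1

/-- The phase to which time `t` belongs, phase `s` being `[K s, K (s + 1))`. -/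
def phase (K : ℕ → ℕ) : ℕ → ℕ
  | 0 => 0
  | t + 1 => if t + 1 = K (phase K t + 1) then phase K t + 1 else phase K t

lemma phase_bounds {K : ℕ → ℕ} (hK0 : K 0 = 0) (hK : StrictMono K) (t : ℕ) :
    K (phase K t) ≤ t ∧ t < K (phase K t + 1) := by
  induction t with
  | zero =>
    have := hK (Nat.lt_succ_self 0)
    simp only [phase, hK0]
    simp only [Nat.succ_eq_add_one] at this
    omega
  | succ t ih =>
    rw [phase]
    split_ifs with h
    · exact ⟨h.ge, h.trans_lt (hK (Nat.lt_succ_self _))⟩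
    · omega

lemma phase_mono (K : ℕ → ℕ) : Monotone (phase K) := by
  refine monotone_nat_of_le_succ fun t => ?_
  rw [phase]
  split_ifs <;> omega

lemma tendsto_phase {K : ℕ → ℕ} (hK0 : K 0 = 0) (hK : StrictMono K) :
    Tendsto (phase K) atTop atTop := by
  refine tendsto_atTop.2 fun s => ?_
  filter_upwards [eventually_ge_atTop (K s)] with t ht
  by_contra hlt
  have h1 := (phase_bounds hK0 hK t).2
  have h2 := hK.monotone (show phase K t + 1 ≤ s by omega)
  omega

lemma exists_phase_starts (M : ℕ → ℕ) :
    ∃ K : ℕ → ℕ, K 0 = 0 ∧ StrictMono K ∧ (∀ s, M (s + 1) ≤ K (s + 1)) ∧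
      ∀ s, (s + 1) * K s ≤ K (s + 1) := by
  let K : ℕ → ℕ := fun s => Nat.rec 0 (fun s k => M (s + 1) + (s + 1) * k + k + 1) s
  have hK : ∀ s, K (s + 1) = M (s + 1) + (s + 1) * K s + K s + 1 := fun s => rfl
  refine ⟨K, rfl, strictMono_nat_of_lt_succ fun s => ?_, fun s => ?_, fun s => ?_⟩ <;>
  · rw [hK]
    omega

variable {Y O : Type} {rmax : ℕ} (W : ℕ → ℝ) (K : ℕ → ℕ)

/-- At time `t + 1`, the leader of `A`, followed since time `k`, has collected less than
promised. -/
def Fails (ω : Traj Y O rmax) (A : Finset ℕ) (k t : ℕ) : Prop :=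
  ∑ i ∈ Finset.Ico k (t + 1), rew (ω i)
    < W (argMax W A) * ((t : ℝ) + 1 - k) - slack (phase K t) * (t + 1)

/-- The experts not refuted in the current phase, and the time since which the leading one
has been followed. -/
def state (ω : Traj Y O rmax) : ℕ → Finset ℕ × ℕ
  | 0 => (Finset.range 1, 0)
  | t + 1 =>
      if t + 1 = K (phase K t + 1) then (Finset.range (phase K t + 2), t + 1)
      else if Fails W K ω (state ω t).1 (state ω t).2 t then
        ((state ω t).1.erase (argMax W (state ω t).1), t + 1)
      else state ω t

variable {W K}

lemma state_congr {ω ω' : Traj Y O rmax} {t : ℕ} (h : ∀ i < t, ω i = ω' i) :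
    state W K ω t = state W K ω' t := by
  induction t with
  | zero => rfl
  | succ t ih =>
    have ih := ih fun i hi => h i (by omega)
    have hf : Fails W K ω (state W K ω t).1 (state W K ω t).2 t
        ↔ Fails W K ω' (state W K ω' t).1 (state W K ω' t).2 t := by
      rw [ih, Fails, Fails, Finset.sum_congr rfl]
      intro i hi
      rw [h i (Finset.mem_Ico.1 hi).2]
    simp only [state, hf]
    rw [ih]

lemma state_start_le (ω : Traj Y O rmax) (t : ℕ) : (state W K ω t).2 ≤ t := by
  induction t with
  | zero => simp [state]
  | succ t ih =>
    rw [state]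
    split_ifs
    · rfl
    · rfl
    · omega

lemma state_eq_of_start_le {ω : Traj Y O rmax} {t t' : ℕ} (htt' : t ≤ t')
    (h : (state W K ω t').2 ≤ t) : state W K ω t' = state W K ω t := by
  induction t', htt' using Nat.le_induction with
  | base => rfl
  | succ u hu ih =>
    rw [state] at h ⊢
    split_ifs at h ⊢ with h1 h2
    · simp only at h; omega
    · simp only at h; omega
    · exact ih h

lemma phase_start (ω : Traj Y O rmax) (t : ℕ) :
    phase K (state W K ω t).2 = phase K t := by
  induction t with
  | zero => simp [state]
  | succ t ih =>
    rw [state]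
    split_ifs with h1 h2
    · rfl
    · rfl
    · rw [ih, phase, if_neg h1]

lemma state_later {ω : Traj Y O rmax} {t t' : ℕ} (htt' : t ≤ t') (h : phase K t' = phase K t) :
    state W K ω t' = state W K ω t ∨
      (state W K ω t').1 ⊆ (state W K ω t).1.erase (argMax W (state W K ω t).1) := by
  induction t', htt' using Nat.le_induction with
  | base => exact Or.inl rfl
  | succ u hu ih =>
    have h1 := phase_mono K hu
    have h2 := phase_mono K (Nat.le_succ u)
    simp only [Nat.succ_eq_add_one] at h2
    have h3 : phase K u = phase K t := by omega
    have hne : u + 1 ≠ K (phase K u + 1) := by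
      intro hb
      rw [phase, if_pos hb] at h
      omega
    rw [state, if_neg hne]
    split_ifs with hf
    · rcases ih h3 with e | e
      · rw [e]; exact Or.inr subset_rfl
      · exact Or.inr ((Finset.erase_subset _ _).trans e)
    · exact ih h3

/-- Expert `T` takes the lead at time `t`, during phase `s`. -/
def TakesLead (W : ℕ → ℝ) (K : ℕ → ℕ) (T s : ℕ) (ω : Traj Y O rmax) (t : ℕ) : Prop :=
  phase K t = s ∧ (state W K ω t).2 = t ∧ T ∈ (state W K ω t).1 ∧ argMax W (state W K ω t).1 = T

lemma TakesLead.unique {T s : ℕ} {ω : Traj Y O rmax} {t t' : ℕ} (h : TakesLead W K T s ω t)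
    (h' : TakesLead W K T s ω t') : t = t' := by
  wlog hlt : t ≤ t' generalizing t t'
  · exact (this h' h (by omega)).symm
  rcases state_later (W := W) (ω := ω) hlt (h'.1.trans h.1.symm) with e | e
  · rw [← h.2.1, ← h'.2.1, e]
  · have := e h'.2.2.1
    simp [h.2.2.2] at this

lemma TakesLead.congr {T s : ℕ} {ω ω' : Traj Y O rmax} {t : ℕ} (h : TakesLead W K T s ω t)
    (hω : ∀ i < t, ω i = ω' i) : TakesLead W K T s ω' t := by
  unfold TakesLead at h ⊢
  rwa [← state_congr hω]

/-- Expert `T`, followed since time `k`, is refuted at time `t + 1`. -/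
def Refuted (W : ℕ → ℝ) (K : ℕ → ℕ) (T s : ℕ) (ω : Traj Y O rmax) (k t : ℕ) : Prop :=
  TakesLead W K T s ω k ∧ (state W K ω t).2 = k ∧ t + 1 ≠ K (phase K t + 1) ∧
    Fails W K ω (state W K ω t).1 (state W K ω t).2 t

lemma Refuted.start_le {T s : ℕ} {ω : Traj Y O rmax} {k t : ℕ} (h : Refuted W K T s ω k t) :
    k ≤ t := h.2.1 ▸ state_start_le ω t

lemma Refuted.unique {T s : ℕ} {ω : Traj Y O rmax} {k t t' : ℕ} (h : Refuted W K T s ω k t)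
    (h' : Refuted W K T s ω k t') : t = t' := by
  wlog hlt : t ≤ t' generalizing t t'
  · exact (this h' h (by omega)).symm
  by_contra hne
  have hk := h.start_le
  have h1 : state W K ω t' = state W K ω (t + 1) :=
    state_eq_of_start_le (by omega) (by rw [h'.2.1]; omega)
  have h2 : (state W K ω (t + 1)).2 = t + 1 := by
    rw [state, if_neg h.2.2.1, if_pos h.2.2.2]
  have := h'.2.1
  rw [h1, h2] at this
  omega

lemma Refuted.congr {T s : ℕ} {ω ω' : Traj Y O rmax} {k t : ℕ} (h : Refuted W K T s ω k t)
    (hω : ∀ i < t + 1, ω i = ω' i) : Refuted W K T s ω' k t := by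
  have hk := h.start_le
  obtain ⟨h1, h2, h3, h4⟩ := h
  have e := state_congr (W := W) (K := K) (ω := ω) (ω' := ω') (t := t) fun i hi => hω i (by omega)
  refine ⟨h1.congr fun i hi => hω i (by omega), e ▸ h2, h3, ?_⟩
  rw [← e]
  unfold Fails at h4 ⊢
  rwa [Finset.sum_congr rfl fun i hi => by rw [← hω i (Finset.mem_Ico.1 hi).2]]

/-- An expert which is not refuted during a phase stays available. -/
lemma mem_state_of_not_refuted {T s : ℕ} (hT : T ≤ s) {ω : Traj Y O rmax}
    (h : ∀ k t, ¬ Refuted W K T s ω k t) (t : ℕ) (ht : phase K t = s) :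
    T ∈ (state W K ω t).1 := by
  induction t with
  | zero =>
    simp only [phase] at ht
    simp only [state, Finset.mem_range]
    omega
  | succ t ih =>
    rw [phase] at ht
    rw [state]
    split_ifs at ht ⊢ with h1 h2
    · simp only [Finset.mem_range]
      omega
    · refine Finset.mem_erase.2 ⟨fun he => h (state W K ω t).2 t ?_, ih ht⟩
      have e := state_eq_of_start_le (W := W) (K := K) (state_start_le ω t) le_rfl
      refine ⟨⟨(phase_start ω t).trans ht, ?_, ?_, ?_⟩, rfl, h1, h2⟩
      · rw [← e]
      · rw [← e]; exact ih ht
      · rw [← e]; exact he.symm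
    · exact ih ht

/-- Cumulative shortfall of the rewards with respect to the target `w`. -/
def shortfall (w : ℝ) (ω : Traj Y O rmax) (t : ℕ) : ℝ := w * t - ∑ i ∈ Finset.range t, rew (ω i)

lemma shortfall_sub (w : ℝ) (ω : Traj Y O rmax) {k t : ℕ} (h : k ≤ t) :
    shortfall w ω t - shortfall w ω k = w * (t - k) - ∑ i ∈ Finset.Ico k t, rew (ω i) := by
  rw [shortfall, shortfall, ← Finset.sum_range_add_sum_Ico (fun i => rew (ω i)) h]
  ring

lemma state_test (ω : Traj Y O rmax) (t : ℕ) :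
    W (argMax W (state W K ω t).1) * ((t : ℝ) - (state W K ω t).2) - slack (phase K t) * t
      ≤ ∑ i ∈ Finset.Ico (state W K ω t).2 t, rew (ω i) := by
  induction t with
  | zero => simp [state]
  | succ t ih =>
    have hs := (slack_pos (phase K (t + 1))).le
    rw [state]
    split_ifs with h1 h2
    · simp; positivity
    · simp; positivity
    · have : phase K (t + 1) = phase K t := by rw [phase, if_neg h1]
      rw [this]
      rw [Fails, not_lt] at h2
      push_cast
      exact h2

lemma card_state_le (ω : Traj Y O rmax) (t : ℕ) :
    (state W K ω t).1.card ≤ phase K t + 1 := by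
  induction t with
  | zero => simp [state]
  | succ t ih =>
    rw [state, phase]
    split_ifs with h1 h2
    · simp
    · exact (Finset.card_le_card (Finset.erase_subset _ _)).trans ih
    · exact ih

/-- Shortfall accumulated during a phase, as long as expert `T` is not refuted. -/
lemma shortfall_start_le (hK0 : K 0 = 0) (hK : StrictMono K) {T : ℕ} (hW : W T ≤ rmax)
    (ω : Traj Y O rmax) {t : ℕ}
    (hr : (rmax : ℝ) ≤ slack (phase K t) * K (phase K t)) (hT : T ∈ (state W K ω t).1) :
    shortfall (W T) ω (state W K ω t).2 - shortfall (W T) ω (K (phase K t)) ≤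
      ((phase K t : ℝ) + 1 - (state W K ω t).1.card) * (2 * slack (phase K t))
        * (state W K ω t).2 := by
  induction t with
  | zero => simp [state, phase, hK0]
  | succ t ih =>
    rw [state] at hT ⊢
    split_ifs at hT ⊢ with h1 h2
    · have : phase K (t + 1) = phase K t + 1 := by rw [phase, if_pos h1]
      rw [this, ← h1]
      simp
      exact mul_nonneg (mul_nonneg (by linarith) (by linarith [slack_pos (phase K t + 1)]))
        (by positivity)
    · have hph : phase K (t + 1) = phase K t := by rw [phase, if_neg h1]
      rw [hph] at hr ⊢
      have hT' := Finset.mem_of_mem_erase hT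
      have ih := ih hr hT'
      have htest := state_test (W := W) (K := K) ω t
      have hkt := state_start_le (W := W) (K := K) ω t
      have hKt := (phase_bounds hK0 hK t).1
      have hcard : (((state W K ω t).1.erase (argMax W (state W K ω t).1)).card : ℝ)
          = (state W K ω t).1.card - 1 := by
        rw [Finset.card_erase_of_mem (argMax_mem W ⟨T, hT'⟩), Nat.cast_sub]
        · simp
        · exact Finset.card_pos.2 ⟨T, hT'⟩
      have hcl : ((state W K ω t).1.card : ℝ) ≤ phase K t + 1 := by
        exact_mod_cast card_state_le ω t
      have hle := le_argMax W hT'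
      simp only [hcard]
      set A := (state W K ω t).1
      set k := (state W K ω t).2
      set s := phase K t
      have hsub := shortfall_sub (W T) ω (show k ≤ t + 1 by omega)
      rw [Finset.sum_Ico_succ_top hkt] at hsub
      have hrew := rew_nonneg (ω t)
      have hη := slack_pos s
      have hkt' : (k : ℝ) ≤ t := by exact_mod_cast hkt
      have hKt' : (K s : ℝ) ≤ t := by exact_mod_cast hKt
      have e1 : W T * (t - k) ≤ W (argMax W A) * (t - k) :=
        mul_le_mul_of_nonneg_right hle (by linarith)
      have e2 : slack s * K s ≤ slack s * t := mul_le_mul_of_nonneg_left hKt' hη.le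
      have e3 : ((s : ℝ) + 1 - A.card) * (2 * slack s) * k
          ≤ ((s : ℝ) + 1 - A.card) * (2 * slack s) * (t + 1) := by
        refine mul_le_mul_of_nonneg_left (by linarith) (mul_nonneg (by linarith) (by linarith))
      push_cast at hsub ⊢
      nlinarith
    · have hph : phase K (t + 1) = phase K t := by rw [phase, if_neg h1]
      rw [hph] at hr ⊢
      exact ih hr hT

lemma shortfall_le (hK0 : K 0 = 0) (hK : StrictMono K) {T : ℕ} (hW : W T ≤ rmax)
    (ω : Traj Y O rmax) {t : ℕ}
    (hr : (rmax : ℝ) ≤ slack (phase K t) * K (phase K t)) (hT : T ∈ (state W K ω t).1) :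
    shortfall (W T) ω t - shortfall (W T) ω (K (phase K t)) ≤
      2 / ((phase K t : ℝ) + 1) * t := by
  have h1 := shortfall_start_le hK0 hK hW ω hr hT
  have h2 := state_test (W := W) (K := K) ω t
  have hkt := state_start_le (W := W) (K := K) ω t
  have hle := le_argMax W hT
  have hcard : (1 : ℝ) ≤ (state W K ω t).1.card := by
    exact_mod_cast Finset.card_pos.2 ⟨T, hT⟩
  have hcl : ((state W K ω t).1.card : ℝ) ≤ phase K t + 1 := by
    exact_mod_cast card_state_le ω t
  have hsub := shortfall_sub (W T) ω hkt
  have hη := slack_pos (phase K t)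
  have hs : 2 / ((phase K t : ℝ) + 1) = (phase K t + 1) * (2 * slack (phase K t)) := by
    unfold slack; field_simp
  rw [hs]
  set A := (state W K ω t).1
  set k := (state W K ω t).2
  set s := phase K t
  have hkt' : (k : ℝ) ≤ t := by exact_mod_cast hkt
  have e1 : W T * (t - k) ≤ W (argMax W A) * (t - k) :=
    mul_le_mul_of_nonneg_right hle (by linarith)
  have e3 : ((s : ℝ) + 1 - A.card) * (2 * slack s) * k
      ≤ ((s : ℝ) + 1 - A.card) * (2 * slack s) * t := by
    refine mul_le_mul_of_nonneg_left hkt' (mul_nonneg (by linarith) (by linarith))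
  have e4 : 0 ≤ ((A.card : ℝ) - 1) * (slack s * t) :=
    mul_nonneg (by linarith) (by positivity)
  have e5 : 0 ≤ slack s * t := by positivity
  nlinarith

lemma shortfall_le_mul {w : ℝ} (hw : w ≤ rmax) (ω : Traj Y O rmax) (t : ℕ) :
    shortfall w ω t ≤ rmax * t := by
  have : 0 ≤ ∑ i ∈ Finset.range t, rew (ω i) := Finset.sum_nonneg fun i _ => rew_nonneg _
  have := mul_le_mul_of_nonneg_right hw (Nat.cast_nonneg (α := ℝ) t)
  rw [shortfall]
  linarith

/-- If expert `T` is available throughout all late phases, then the limiting average reward is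
at least `W T`. -/
lemma le_liminf_avg (hK0 : K 0 = 0) (hK : StrictMono K)
    (hgrow : ∀ s, (s + 1) * K s ≤ K (s + 1)) {T : ℕ} (hW : W T ≤ rmax)
    (hr : ∀ s, (rmax : ℝ) ≤ slack (s + 1) * K (s + 1)) {ω : Traj Y O rmax}
    (hT : ∀ᶠ s in atTop, ∀ t, phase K t = s → T ∈ (state W K ω t).1) :
    W T ≤ liminf (avg ω) atTop := by
  obtain ⟨S, hS⟩ := eventually_atTop.1 hT
  have hbound : ∀ s, S + 1 ≤ s → ∀ t, phase K t = s + 1 →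
      shortfall (W T) ω t ≤ (2 * (rmax : ℝ) + 4) / (s + 1) * t := by
    intro s hs t ht
    obtain ⟨b1, b2⟩ := phase_bounds hK0 hK t
    rw [ht] at b1 b2
    obtain ⟨u, rfl⟩ : ∃ u, s = u + 1 := ⟨s - 1, by omega⟩
    have hK1 : 0 < K (u + 1) := (Nat.zero_le _).trans_lt (hK (Nat.lt_succ_self u))
    have hK2 : K (u + 1) < K (u + 1 + 1) := hK (Nat.lt_succ_self _)
    obtain ⟨a, ha⟩ : ∃ a, K (u + 1 + 1) = a + 1 := ⟨K (u + 1 + 1) - 1, by omega⟩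
    have hpa : phase K a = u + 1 := by
      obtain ⟨c1, c2⟩ := phase_bounds hK0 hK a
      have h1 : phase K a < u + 1 + 1 := hK.lt_iff_lt.1 (by omega)
      have h2 : u + 1 < phase K a + 1 := hK.lt_iff_lt.1 (by omega)
      omega
    have e1 := shortfall_le hK0 hK hW ω (t := t) (by rw [ht]; exact hr _) (hS _ (by omega) t ht)
    have e2 := shortfall_le hK0 hK hW ω (t := a) (by rw [hpa]; exact hr _)
      (hS _ (by omega) a hpa)
    rw [ht] at e1
    rw [hpa] at e2
    have e3 := shortfall_le_mul hW ω (K (u + 1))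
    have e4 : shortfall (W T) ω (a + 1) - shortfall (W T) ω a ≤ rmax := by
      rw [shortfall_sub _ _ (Nat.le_succ a)]
      have := rew_nonneg (ω a)
      simp
      linarith
    rw [ha] at e1 b1
    have b1' : (a : ℝ) + 1 ≤ t := by exact_mod_cast b1
    have hK1' : (1 : ℝ) ≤ K (u + 1) := by exact_mod_cast hK1
    have hg : ((u : ℝ) + 1 + 1) * K (u + 1) ≤ t := by
      refine le_trans ?_ b1'
      have := hgrow (u + 1)
      rw [ha] at this
      exact_mod_cast this
    have hu : (0 : ℝ) < u + 1 + 1 := by positivity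
    have e5 : 2 / ((u : ℝ) + 1 + 1 + 1) * t ≤ 2 / ((u : ℝ) + 1 + 1) * t := by
      gcongr
      linarith
    have e6 : 2 / ((u : ℝ) + 1 + 1) * a ≤ 2 / ((u : ℝ) + 1 + 1) * t := by
      gcongr
      linarith
    have e7 : (rmax : ℝ) * K (u + 1) ≤ rmax / ((u : ℝ) + 1 + 1) * t := by
      rw [div_mul_eq_mul_div, le_div_iff₀ hu]
      have := mul_le_mul_of_nonneg_left hg (Nat.cast_nonneg (α := ℝ) rmax)
      linarith
    have e8 : (rmax : ℝ) ≤ rmax * K (u + 1) :=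
      le_mul_of_one_le_right (by positivity) hK1'
    have e9 : (2 * (rmax : ℝ) + 4) / ((u : ℝ) + 1 + 1) * t = 2 * (rmax / ((u : ℝ) + 1 + 1) * t)
        + 2 * (2 / ((u : ℝ) + 1 + 1) * t) := by ring
    push_cast at e1 e2 ⊢
    linarith
  have hkey : ∀ ε : ℝ, 0 < ε → ∀ᶠ t in atTop, W T - ε ≤ avg ω t := by
    intro ε hε
    obtain ⟨N, hN⟩ := exists_nat_gt ((2 * (rmax : ℝ) + 4) / ε)
    filter_upwards [(tendsto_phase hK0 hK).eventually_ge_atTop (S + N + 2),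
      eventually_gt_atTop 0] with t ht ht0
    obtain ⟨s, hs⟩ : ∃ s, phase K t = s + 1 := ⟨phase K t - 1, by omega⟩
    have h1 := hbound s (by omega) t hs
    have ht0' : (0 : ℝ) < t := by exact_mod_cast ht0
    have hNs : (N : ℝ) ≤ s + 1 := by exact_mod_cast (by omega : N ≤ s + 1)
    have h2 : (2 * (rmax : ℝ) + 4) / (s + 1) ≤ ε := by
      rw [div_lt_iff₀ hε] at hN
      rw [div_le_iff₀ (by positivity)]
      nlinarith
    have h3 := mul_le_mul_of_nonneg_right h2 ht0'.le
    rw [avg, le_div_iff₀ ht0']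
    rw [shortfall] at h1
    linarith
  refine le_of_forall_pos_le_add fun ε hε => ?_
  rw [← sub_le_iff_le_add]
  refine le_liminf_of_le ?_ (hkey ε hε)
  refine IsBoundedUnder.isCoboundedUnder_ge ⟨rmax, ?_⟩
  refine eventually_map.2 (Eventually.of_forall fun t => ?_)
  refine div_le_of_le_mul₀ (by positivity) (by positivity) ?_
  calc ∑ i ∈ Finset.range t, rew (ω i) ≤ ∑ i ∈ Finset.range t, (rmax : ℝ) :=
        Finset.sum_le_sum fun i _ => rew_le _
    _ = rmax * t := by simp [mul_comm]

end Strategy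

section Probability

variable {Y O : Type} {rmax : ℕ} [Nonempty (Cycle Y O rmax)]
  (W : ℕ → ℝ) (K : ℕ → ℕ) (pol : ℕ → List (Cycle Y O rmax) → Policy Y O rmax)

/-- The policy which always follows the leading expert, restarted at the history at which it
took the lead. -/
def followLeader : Policy Y O rmax := fun g =>
  pol (argMax W (state W K (extend g) g.length).1)
    (g.take (state W K (extend g) g.length).2) g

variable {W K pol}

lemma followLeader_initSeg (ω : Traj Y O rmax) (t : ℕ) :
    followLeader W K pol (initSeg ω t) =
      pol (argMax W (state W K ω t).1) (initSeg ω (state W K ω t).2) (initSeg ω t) := by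
  have e : state W K (extend (initSeg ω t)) t = state W K ω t :=
    state_congr fun i hi => extend_initSeg ω hi
  rw [followLeader, length_initSeg, e, take_initSeg ω (state_start_le ω t)]

variable [Fintype Y] [Fintype O]

/-- After the expert `T` has taken the lead at time `k`, it is unlikely to be refuted. -/
lemma measure_refuted_from_le (ν : Environment Y O rmax) {T s : ℕ} {δ : ℝ≥0∞}
    {v : Traj Y O rmax} {k : ℕ}
    (hδ : condProb ν (pol T (initSeg v k)) (initSeg v k)
      {ω | ∃ n : ℕ, ∑ i ∈ Finset.Ico k (k + n + 1), rew (ω i)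
            < W T * (n + 1) - slack s * (k + n + 1)} ≤ δ) :
    ν.P (followLeader W K pol) (cylSet (initSeg v k) ∩ {ω | ∃ n, Refuted W K T s ω k (k + n)})
      ≤ ν.P (followLeader W K pol) (cylSet (initSeg v k)) * δ := by
  set p := followLeader W K pol
  set q := replacePolicy (initSeg v k) (pol T (initSeg v k)) with hq
  set C := cylSet (initSeg v k) with hC
  rcases eq_or_ne (ν.P p C) 0 with h0 | h0
  · rw [h0, zero_mul]
    exact (measure_mono_null Set.inter_subset_left h0).le
  have hpq : ∀ ω ∈ C, ∀ i < k, p (initSeg ω i) = q (initSeg ω i) := by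
    intro ω hω i hi
    have hωv : initSeg ω k = initSeg v k := initSeg_congr (mem_cylSet_initSeg.1 hω)
    have h0' : ν.P p (cylSet (initSeg ω k)) ≠ 0 := by rwa [hωv]
    rw [← action_eq_of_measure_ne_zero ν h0' hi, hq, replacePolicy,
      dif_pos (by simpa using hi)]
    simp [initSeg, mem_cylSet_initSeg.1 hω i hi]
  have hCpq : ν.P p C = ν.P q C :=
    measure_cylSet_congr ν v k (hpq v (self_mem_cylSet v k))
  let E : ℕ → Set (Traj Y O rmax) := fun n => C ∩ {ω | Refuted W K T s ω k (k + n)}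
  have hstate : ∀ n, ∀ ω ∈ E n, ∀ i, k ≤ i → i ≤ k + n →
      (state W K ω i).2 = k ∧ argMax W (state W K ω i).1 = T ∧ phase K i = s := by
    rintro n ω ⟨-, h⟩ i h1 h2
    have e1 : state W K ω (k + n) = state W K ω k :=
      state_eq_of_start_le (by omega) h.2.1.le
    have e2 : state W K ω (k + n) = state W K ω i :=
      state_eq_of_start_le h2 (h.2.1.le.trans h1)
    rw [← e2, e1]
    refine ⟨h.1.2.1, h.1.2.2.2, ?_⟩
    rw [← phase_start (W := W) ω i, ← e2, e1, phase_start, h.1.1]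
  have hdet : ∀ n, ∀ ω ω' : Traj Y O rmax, (∀ i < k + n + 1, ω i = ω' i) → ω ∈ E n → ω' ∈ E n := by
    rintro n ω ω' h ⟨h1, h2⟩
    refine ⟨mem_cylSet_initSeg.2 fun i hi => ?_, Refuted.congr h2 h⟩
    rw [← h i (by omega)]
    exact mem_cylSet_initSeg.1 h1 i hi
  have hE : C ∩ {ω | ∃ n, Refuted W K T s ω k (k + n)} = ⋃ n, E n := by
    ext ω; simp [E]
  have hdisj : Pairwise (Function.onFun Disjoint E) := by
    intro m n hmn
    refine Set.disjoint_left.2 fun ω h1 h2 => hmn ?_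
    have := Refuted.unique h1.2 h2.2
    omega
  have hmeas : ∀ n, MeasurableSet (E n) := fun n =>
    measurableSet_of_determined (k + n + 1) (hdet n)
  have hEpq : ∀ n, ν.P p (E n) = ν.P q (E n) := by
    intro n
    refine measure_congr_of_determined ν (k + n + 1) (hdet n) fun ω hω i hi => ?_
    rcases lt_or_ge i k with hik | hik
    · exact hpq ω hω.1 i hik
    · obtain ⟨e1, e2, -⟩ := hstate n ω hω i hik (by omega)
      rw [show p = followLeader W K pol from rfl, followLeader_initSeg, e1, e2, hq, replacePolicy, dif_neg (by simpa using hik),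
        initSeg_congr (mem_cylSet_initSeg.1 hω.1)]
  have hfin : ν.P p (⋃ n, E n) = ν.P q (⋃ n, E n) := by
    rw [measure_iUnion hdisj hmeas, measure_iUnion hdisj hmeas]
    simp only [hEpq]
  rw [hE, hfin, hCpq]
  rw [hCpq] at h0
  have hsub : ν.P q (⋃ n, E n) ≤ ν.P q (C ∩ {ω | ∃ n : ℕ,
      ∑ i ∈ Finset.Ico k (k + n + 1), rew (ω i) < W T * (n + 1) - slack s * (k + n + 1)}) := by
    refine measure_mono (Set.iUnion_subset fun n ω hω => ⟨hω.1, n, ?_⟩)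
    obtain ⟨e1, e2, e3⟩ := hstate n ω hω (k + n) (by omega) le_rfl
    have hf := hω.2.2.2.2
    rw [Fails, e1, e2, e3] at hf
    push_cast at hf
    convert hf using 2
    ring
  refine hsub.trans ?_
  rw [condProb, condMeasure, ProbabilityTheory.cond_apply (measurableSet_cylSet _)] at hδ
  rw [mul_comm]
  rw [← ENNReal.div_le_iff_le_mul (Or.inl h0) (Or.inl (measure_ne_top _ _)),
    ENNReal.div_eq_inv_mul]
  exact hδ

lemma measure_refuted_le (ν : Environment Y O rmax) (hK0 : K 0 = 0) (hK : StrictMono K)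
    {T s : ℕ} {δ : ℝ≥0∞}
    (hδ : ∀ h : List (Cycle Y O rmax), K s ≤ h.length → condProb ν (pol T h) h
      {ω | ∃ n : ℕ, ∑ i ∈ Finset.Ico h.length (h.length + n + 1), rew (ω i)
            < W T * (n + 1) - slack s * (h.length + n + 1)} ≤ δ) :
    ν.P (followLeader W K pol) {ω | ∃ k t, Refuted W K T s ω k t} ≤ δ := by
  let H := {h : List (Cycle Y O rmax) // ∃ v, TakesLead W K T s v h.length ∧ v ∈ cylSet h}
  have hsub : {ω : Traj Y O rmax | ∃ k t, Refuted W K T s ω k t} ⊆ ⋃ h : H,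
      cylSet h.1 ∩ {ω | ∃ n, Refuted W K T s ω h.1.length (h.1.length + n)} := by
    rintro ω ⟨k, t, h⟩
    refine Set.mem_iUnion.2 ⟨⟨initSeg ω k, ω, ?_, self_mem_cylSet ω k⟩,
      self_mem_cylSet ω k, t - k, ?_⟩
    · simpa using h.1
    · have := h.start_le
      simpa [show k + (t - k) = t by omega] using h
  have hdisj : Pairwise (Function.onFun Disjoint fun h : H => cylSet h.1) := by
    rintro ⟨g, v, hv, hvg⟩ ⟨h, w, hw, hwh⟩ hne
    refine Set.disjoint_left.2 fun ω h1 h2 => hne (Subtype.ext ?_)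
    have a1 : TakesLead W K T s ω g.length := hv.congr fun i hi => by
      rw [← extend_of_mem hvg hi, ← extend_of_mem h1 hi]
    have a2 : TakesLead W K T s ω h.length := hw.congr fun i hi => by
      rw [← extend_of_mem hwh hi, ← extend_of_mem h2 hi]
    have := a1.unique a2
    exact (initSeg_eq_of_mem h1).symm.trans ((congrArg (initSeg ω) this).trans (initSeg_eq_of_mem h2))
  calc ν.P (followLeader W K pol) {ω | ∃ k t, Refuted W K T s ω k t}
      ≤ ∑' h : H, ν.P (followLeader W K pol) (cylSet h.1 ∩
          {ω | ∃ n, Refuted W K T s ω h.1.length (h.1.length + n)}) :=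
        (measure_mono hsub).trans (measure_iUnion_le _)
    _ ≤ ∑' h : H, ν.P (followLeader W K pol) (cylSet h.1) * δ := by
        refine ENNReal.tsum_le_tsum ?_
        rintro ⟨h, v, hv, hvh⟩
        have e := initSeg_eq_of_mem hvh
        have hle : K s ≤ h.length := by
          have := (phase_bounds hK0 hK h.length).1
          rwa [hv.1] at this
        have := measure_refuted_from_le (K := K) (pol := pol) (δ := δ) ν (by rw [e]; exact hδ h hle)
        rwa [e] at this
    _ = ν.P (followLeader W K pol) (⋃ h : H, cylSet h.1) * δ := by
        rw [ENNReal.tsum_mul_right, measure_iUnion hdisj fun h => measurableSet_cylSet _]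
    _ ≤ 1 * δ := by gcongr; exact prob_le_one
    _ = δ := one_mul _

end Probability

/-- **Theorem 3(i) (worst-case self-optimizing).**
For any countable set `C` of worst-case value-stable environments there exists a policy `p`
with `liminf_m (1/m) r_{1..m}^{pν} ≥ W*_ν` with probability 1 for every `ν ∈ C`. -/
theorem worstCase_selfOptimizing {Y O : Type} [Fintype Y] [Fintype O]
    [Nonempty Y] [Nonempty O] {rmax : ℕ}
    (C : Set (Environment Y O rmax)) (hcount : C.Countable)
    (hwvs : ∀ ν ∈ C, WorstCaseValueStable ν) :
    ∃ p : Policy Y O rmax, ∀ ν ∈ C,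
      ν.P p {ω | Wstar ν ≤ liminf (avg ω) atTop} = 1 := by
  rcases C.eq_empty_or_nonempty with rfl | hne
  · exact ⟨fun _ => Classical.arbitrary Y, by simp⟩
  obtain ⟨f, rfl⟩ := hcount.exists_eq_range hne
  have hcore : ∀ i, ∃ r d φ, ValueStableCore (f i) (Wstar (f i)) r d φ :=
    fun i => (hwvs (f i) ⟨i, rfl⟩).2
  choose r d φ hcore using hcore
  have hW : ∀ i, Wstar (f i) ≤ rmax := fun i => (hcore i).target_le
  choose pol hpol using fun i => (hcore i).exists_policy
  choose M hM using fun i s => hpol i (slack s) (slack_pos s) (2⁻¹ ^ s)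
    (ENNReal.pow_pos (by simp) s)
  obtain ⟨K, hK0, hK, hKM, hgrow⟩ := exists_phase_starts
    fun s => ⌈(rmax : ℝ) / slack s⌉₊ + ∑ i ∈ Finset.range (s + 1), M i s
  have hr : ∀ s, (rmax : ℝ) ≤ slack (s + 1) * K (s + 1) := by
    intro s
    rw [← div_le_iff₀' (slack_pos _)]
    refine (Nat.le_ceil _).trans ?_
    exact_mod_cast (Nat.le_add_right _ _).trans (hKM s)
  have hMK : ∀ i s, i ≤ s + 1 → M i (s + 1) ≤ K (s + 1) := by
    intro i s hi
    refine le_trans ?_ ((Nat.le_add_left _ _).trans (hKM s))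
    exact Finset.single_le_sum (f := fun i => M i (s + 1)) (fun _ _ => Nat.zero_le _)
      (Finset.mem_range.2 (by omega))
  refine ⟨followLeader (fun i => Wstar (f i)) K pol, ?_⟩
  rintro _ ⟨T, rfl⟩
  set p := followLeader (fun i => Wstar (f i)) K pol
  have hsum : ∑' s, (f T).P p {ω | ∃ k t, Refuted (fun i => Wstar (f i)) K T (T + 1 + s) ω k t}
      ≠ ⊤ := by
    have hle : ∀ s, (f T).P p
        {ω | ∃ k t, Refuted (fun i => Wstar (f i)) K T (T + 1 + s) ω k t} ≤ 2⁻¹ ^ s := by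
      intro s
      refine (measure_refuted_le (f T) hK0 hK fun h hh => hM T _ h ?_).trans
        (pow_le_pow_right_of_le_one' (by simp) (show s ≤ T + 1 + s by omega))
      rw [show T + 1 + s = (T + s) + 1 by omega] at hh ⊢
      exact (hMK T (T + s) (by omega)).trans hh
    refine ne_top_of_le_ne_top ?_ (ENNReal.tsum_le_tsum hle)
    rw [ENNReal.tsum_geometric_two]
    simp
  have hae := ae_eventually_notMem hsum
  rw [← measure_univ (μ := (f T).P p)]
  refine measure_congr (eventuallyEq_univ.2 ?_)
  filter_upwards [hae] with ω hω
  refine le_liminf_avg (W := fun i => Wstar (f i)) hK0 hK hgrow (hW T) hr ?_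
  obtain ⟨S, hS⟩ := eventually_atTop.1 hω
  filter_upwards [eventually_ge_atTop (T + 1 + S)] with s hs
  obtain ⟨u, rfl⟩ : ∃ u, s = T + 1 + u := ⟨s - (T + 1), by omega⟩
  exact mem_state_of_not_refuted (by omega) fun k t hkt => hS u (by omega) ⟨k, t, hkt⟩

end RL
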